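/- arXiv:2311.04776 — 3 statements merged into one kernel-verified Lean document; each statement's English description precedes it below -/
import Mathlib

section
/- For subbands with initial frequencies f_m = f_0 + (m-1)B and f_n = f_0 + (n-1)B (m, n positive integers), any l ∈ {1,…,ξ}, and the complex superimposed chirps c_{m,l}, c_{n,l}: if m ≠ n then ∫_0^T c_{m,l}(t) · conj(c_{n,l}(t)) dt = 0, while if m = n the integral equals T. (In particular, taking l = 1 this gives the orthogonality over [0,T] of the basic complex up-chirps exp(2πi t (f_0 + (n-1)B + μt/2)) over distinct subbands.) -/
open Real intervalIntegral

/-- A complex exponential of nonzero frequency `ν` integrates to zero over `[0, T]` when `T` is an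
integer number of periods. -/
theorem integral_exp_two_pi_mul_I_eq_zero {ν T : ℝ} (hν : ν ≠ 0) (k : ℤ) (hk : ν * T = k) :
    ∫ t in (0 : ℝ)..T, Complex.exp (2 * π * Complex.I * ν * t) = 0 := by
  have hne : 2 * (π : ℂ) * Complex.I * ν ≠ 0 :=
    mul_ne_zero Complex.two_pi_I_ne_zero (Complex.ofReal_ne_zero.mpr hν)
  have hexp : Complex.exp (2 * π * Complex.I * ν * T) = 1 := by
    rw [Complex.exp_eq_one_iff]
    refine ⟨k, ?_⟩
    have hkC : (ν : ℂ) * T = k := by exact_mod_cast hk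
    rw [← hkC]
    ring
  rw [integral_exp_mul_complex hne, hexp]
  simp

/-- The product of a unimodular exponential with the conjugate of another one is the exponential of
the phase difference. -/
theorem exp_I_mul_mul_conj_exp_I_mul (x y : ℝ) :
    Complex.exp (Complex.I * x) * (starRingEnd ℂ) (Complex.exp (Complex.I * y)) =
      Complex.exp (Complex.I * (x - y : ℝ)) := by
  rw [← Complex.exp_conj, ← Complex.exp_add]
  congr 1
  simp only [map_mul, Complex.conj_I, Complex.conj_ofReal]
  push_cast
  ring

/-- Orthogonality of the complex superimposed chirps across distinct
subbands: with `T = ξ/B`, `μ = B/T`, `T_l = T(1 - (l-1)/ξ)` and the piecewise phase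
`θ_{n,l}`, the complex chirps `c_{n,l}(t) = exp(i θ_{n,l}(t))` satisfy
`∫_0^T c_{m,l} conj(c_{n,l}) dt = 0` for `m ≠ n`, and the integral equals `T` for `m = n`. -/
theorem superimposed_chirp_subband_orthogonality
    (B : ℝ) (hB : 0 < B) (ξ : ℕ) (hξ : 0 < ξ) (f₀ : ℝ)
    (l : ℕ) (hl1 : 1 ≤ l) (hl2 : l ≤ ξ)
    (T μ Tl : ℝ) (hT : T = (ξ : ℝ) / B) (hμ : μ = B / T)
    (hTl : Tl = T * (1 - ((l : ℝ) - 1) / (ξ : ℝ)))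
    (θ : ℕ → ℝ → ℝ)
    (hθ : ∀ n t, θ n t =
      if t ≤ Tl then
        2 * π * t * ((f₀ + ((n : ℝ) - 1) * B) + (((l : ℝ) - 1) / (ξ : ℝ)) * B + (μ / 2) * t)
      else
        2 * π * t * ((f₀ + ((n : ℝ) - 1) * B) + (((l : ℝ) - 1 - (ξ : ℝ)) / (ξ : ℝ)) * B
          + (μ / 2) * t))
    (c : ℕ → ℝ → ℂ)
    (hc : ∀ n t, c n t = Complex.exp (Complex.I * (θ n t : ℂ)))
    (m n : ℕ) (hm : 1 ≤ m) (hn : 1 ≤ n) :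
    (m ≠ n → (∫ t in (0 : ℝ)..T, c m t * (starRingEnd ℂ) (c n t)) = 0) ∧
    (m = n → (∫ t in (0 : ℝ)..T, c m t * (starRingEnd ℂ) (c n t)) = (T : ℂ)) := by
  have hprod : ∀ t, c m t * (starRingEnd ℂ) (c n t) =
      Complex.exp (2 * π * Complex.I * (((m : ℝ) - n) * B : ℝ) * t) := by
    intro t
    have hdiff : θ m t - θ n t = 2 * π * (((m : ℝ) - n) * B) * t := by
      rw [hθ, hθ]
      split_ifs <;> ring
    rw [hc, hc, exp_I_mul_mul_conj_exp_I_mul, hdiff]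
    congr 1
    push_cast
    ring
  simp only [hprod]
  constructor
  · intro hmn
    have hsub : (m : ℝ) - n ≠ 0 := sub_ne_zero.mpr (Nat.cast_injective.ne hmn)
    refine integral_exp_two_pi_mul_I_eq_zero (mul_ne_zero hsub hB.ne') (((m : ℤ) - n) * ξ) ?_
    rw [hT]
    push_cast
    field_simp
  · rintro rfl
    simp
end

section
/- At every time instant the instantaneous frequencies of two distinct superimposed chirps in the same subband are separated by a nonzero multiple of B/ξ: for l ≠ l' in {1,…,ξ} and every t ∈ [0, T] (with the piecewise definitions of ν_{n,l} and ν_{n,l'} at t), the difference ν_{n,l}(t) − ν_{n,l'}(t) equals ((l − l') + kξ)·B/ξ for some k ∈ {−1, 0, 1}, is congruent to (l − l')·B/ξ modulo B, and is nonzero. -/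
open Real

/-- At every time instant the instantaneous frequencies of two distinct
superimposed chirps in the same subband are separated by a nonzero multiple of `B/ξ`:
for `l ≠ l'` in `{1, …, ξ}` and `t ∈ [0, T]`, the difference `ν_{n,l}(t) − ν_{n,l'}(t)` equals
`((l − l') + kξ)·B/ξ` for some `k ∈ {−1, 0, 1}`, is congruent to `(l − l')·B/ξ` modulo `B`,
and is nonzero. -/
theorem superimposed_chirp_frequency_separation
    (B : ℝ) (hB : 0 < B) (ξ : ℕ) (hξ : 0 < ξ) (fn : ℝ)
    (T μ : ℝ) (hT : T = (ξ : ℝ) / B) (hμ : μ = B / T)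
    (Tl : ℕ → ℝ) (hTl : ∀ l, Tl l = T * (1 - ((l : ℝ) - 1) / (ξ : ℝ)))
    (ν : ℕ → ℝ → ℝ)
    (hν : ∀ l t, ν l t =
      if t ≤ Tl l then fn + (((l : ℝ) - 1) / (ξ : ℝ)) * B + μ * t
      else fn + (((l : ℝ) - 1 - (ξ : ℝ)) / (ξ : ℝ)) * B + μ * t)
    (l l' : ℕ) (hl1 : 1 ≤ l) (hl2 : l ≤ ξ) (hl'1 : 1 ≤ l') (hl'2 : l' ≤ ξ)
    (hne : l ≠ l') (t : ℝ) (ht : t ∈ Set.Icc (0 : ℝ) T) :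
    (∃ k : ℤ, (k = -1 ∨ k = 0 ∨ k = 1) ∧
        ν l t - ν l' t = (((l : ℝ) - (l' : ℝ)) + (k : ℝ) * (ξ : ℝ)) * B / (ξ : ℝ)) ∧
    (∃ m : ℤ, ν l t - ν l' t - ((l : ℝ) - (l' : ℝ)) * B / (ξ : ℝ) = (m : ℝ) * B) ∧
    ν l t - ν l' t ≠ 0 := by
  have hξ0 : (ξ : ℝ) ≠ 0 := by exact_mod_cast hξ.ne'
  obtain ⟨k, hk, hkν⟩ : ∃ k : ℤ, (k = -1 ∨ k = 0 ∨ k = 1) ∧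
      ν l t - ν l' t = (((l : ℝ) - (l' : ℝ)) + (k : ℝ) * (ξ : ℝ)) * B / (ξ : ℝ) := by
    rw [hν l t, hν l' t]
    split_ifs
    · exact ⟨0, by simp, by push_cast; field_simp; ring⟩
    · exact ⟨1, by simp, by push_cast; field_simp; ring⟩
    · exact ⟨-1, by simp, by push_cast; field_simp; ring⟩
    · exact ⟨0, by simp, by push_cast; field_simp; ring⟩
  refine ⟨⟨k, hk, hkν⟩, ⟨k, by rw [hkν]; field_simp; ring⟩, ?_⟩
  have hint : (l : ℤ) - l' + k * ξ ≠ 0 := by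
    rcases hk with rfl | rfl | rfl <;> omega
  have hreal : (l : ℝ) - l' + k * ξ ≠ 0 := by exact_mod_cast hint
  rw [hkν]
  exact div_ne_zero (mul_ne_zero hreal hB.ne') hξ0
end

section
/- For the chirp-2 configuration (ξ = 2, so T = 2/B and T_2 = T/2), the low-frequency (difference-frequency) component of the correlation between the two superimposed chirps in a subband vanishes exactly: ∫_0^T cos(θ_{n,2}(t) − θ_{n,1}(t)) dt = 0, equivalently Re ∫_0^T c_{n,2}(t) · conj(c_{n,1}(t)) dt = 0, where θ_{n,2}(t) − θ_{n,1}(t) = πBt for 0 ≤ t ≤ T/2 and θ_{n,2}(t) − θ_{n,1}(t) = −πBt for T/2 < t ≤ T. -/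
open Real intervalIntegral

/-- The integral of `cos (π B t)` over one full period `[0, 2 / B]` vanishes. -/
theorem integral_cos_pi_mul_full_period {B : ℝ} (hB : B ≠ 0) :
    ∫ t in (0 : ℝ)..(2 / B), Real.cos (π * B * t) = 0 := by
  have hend : π * B * (2 / B) = 2 * π := by field_simp
  rw [intervalIntegral.integral_comp_mul_left (fun x => Real.cos x) (mul_ne_zero pi_ne_zero hB),
    integral_cos, hend]
  simp

/-- A measurable unimodular exponential is integrable on every bounded interval. -/
theorem intervalIntegrable_cexp_I_mul {φ : ℝ → ℝ} (hφ : Measurable φ) (a b : ℝ) :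
    IntervalIntegrable (fun t => Complex.exp (Complex.I * (φ t : ℂ))) MeasureTheory.volume a b := by
  refine (intervalIntegrable_const (c := (1 : ℝ))).mono_fun
    (by fun_prop) (Filter.Eventually.of_forall fun t => ?_)
  simp [mul_comm Complex.I, Complex.norm_exp_ofReal_mul_I]

/-- For the chirp-2 configuration (`ξ = 2`, so `T = 2/B` and `T₂ = T/2`),
the low-frequency (difference-frequency) component of the correlation between the two
superimposed chirps in a subband vanishes exactly:
`∫_0^T cos(θ_{n,2}(t) − θ_{n,1}(t)) dt = 0`, equivalently
`Re ∫_0^T c_{n,2}(t) conj(c_{n,1}(t)) dt = 0`, where the phase difference is `πBt` on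
`[0, T/2]` and `−πBt` on `(T/2, T]`. -/
theorem chirp2_difference_frequency_component_vanishes
    (B : ℝ) (hB : 0 < B) (fn : ℝ)
    (T μ : ℝ) (hT : T = 2 / B) (hμ : μ = B / T)
    (θ₁ θ₂ : ℝ → ℝ)
    (hθ₁ : ∀ t, θ₁ t = 2 * π * t * (fn + (μ / 2) * t))
    (hθ₂ : ∀ t, θ₂ t =
      if t ≤ T / 2 then 2 * π * t * (fn + (1 / 2) * B + (μ / 2) * t)
      else 2 * π * t * (fn + (-1 / 2) * B + (μ / 2) * t))
    (hdiff : ∀ t, 0 ≤ t → t ≤ T →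
      θ₂ t - θ₁ t = if t ≤ T / 2 then π * B * t else -(π * B * t))
    (c₁ c₂ : ℝ → ℂ)
    (hc₁ : ∀ t, c₁ t = Complex.exp (Complex.I * (θ₁ t : ℂ)))
    (hc₂ : ∀ t, c₂ t = Complex.exp (Complex.I * (θ₂ t : ℂ))) :
    (∫ t in (0 : ℝ)..T, Real.cos (θ₂ t - θ₁ t)) = 0 ∧
    (∫ t in (0 : ℝ)..T, c₂ t * (starRingEnd ℂ) (c₁ t)).re = 0 := by
  have hphase : ∀ t, θ₂ t - θ₁ t = if t ≤ T / 2 then π * B * t else -(π * B * t) := by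
    intro t
    rw [hθ₁, hθ₂]
    split_ifs <;> ring
  have hcos : ∀ t, Real.cos (θ₂ t - θ₁ t) = Real.cos (π * B * t) := by
    intro t
    rw [hphase]
    split_ifs
    · rfl
    · exact Real.cos_neg _
  have hzero : (∫ t in (0 : ℝ)..T, Real.cos (θ₂ t - θ₁ t)) = 0 := by
    simp only [hcos, hT]
    exact integral_cos_pi_mul_full_period hB.ne'
  refine ⟨hzero, ?_⟩
  have hmeas : Measurable fun t => θ₂ t - θ₁ t := by
    simp only [hphase]
    exact Measurable.ite measurableSet_Iic (by fun_prop) (by fun_prop)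
  have hcorr : ∀ t, c₂ t * (starRingEnd ℂ) (c₁ t) =
      Complex.exp (Complex.I * ((θ₂ t - θ₁ t : ℝ) : ℂ)) := by
    intro t
    rw [hc₁, hc₂, ← Complex.exp_conj, ← Complex.exp_add]
    simp only [map_mul, Complex.conj_I, Complex.conj_ofReal, Complex.ofReal_sub]
    ring_nf
  have hre := Complex.reCLM.intervalIntegral_comp_comm
    (intervalIntegrable_cexp_I_mul hmeas 0 T)
  simp only [Complex.reCLM_apply, mul_comm Complex.I, Complex.exp_ofReal_mul_I_re] at hre
  simp only [hcorr, mul_comm Complex.I]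
  rw [← hre, hzero]
end
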